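/- Let √n·X₁, …, √n·X_m, z be i.i.d. N(0, I_n) random vectors, with m = m_n and λ = λ_n depending on n. Define ℬ_{n,m} = (m−1)·(1+λ²/n)^{−n/2}·exp( (λ²/(2(n+λ²)))·‖z+λX₁‖₂² ) / exp( (λ²/2)‖X₁‖₂² + λX₁ᵀz ). Suppose m → ∞ and (log m)/n → 0. If λ > 0 and λ² ≤ (2−δ)·log m for a fixed constant δ ∈ (0,1), then ℬ_{n,m} → ∞ in probability, i.e. for every M > 0, P(ℬ_{n,m} > M) → 1 as n → ∞. -/

import Mathlib

open MeasureTheory ProbabilityTheory Filter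
open scoped NNReal ENNReal

noncomputable section

/-- The joint law of `(X₁, …, X_m, z)` where the `X_j` are i.i.d. `N(0, (1/n) I_n)` and
`z ~ N(0, I_n)` is independent of them. -/
def XZlaw (n m : ℕ) : Measure ((Fin m → Fin n → ℝ) × (Fin n → ℝ)) :=
  (Measure.pi fun _ : Fin m => Measure.pi fun _ : Fin n => gaussianReal 0 (n : ℝ≥0)⁻¹).prod
    (Measure.pi fun _ : Fin n => gaussianReal 0 1)

/-- The random variable
`ℬ_{n,m} = (m−1)(1+λ²/n)^{−n/2} exp(λ²/(2(n+λ²)) ‖z+λX₁‖²) / exp((λ²/2)‖X₁‖² + λ X₁ᵀz)`,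
written in terms of `X₁ = ω.1 i₀` (the first of the `m` Gaussian vectors) and `z = ω.2`. -/
def Bnm (n m : ℕ) (hm : 0 < m) (lam : ℝ)
    (ω : (Fin m → Fin n → ℝ) × (Fin n → ℝ)) : ℝ :=
  ((m : ℝ) - 1) * (1 + lam ^ 2 / n) ^ (-(n : ℝ) / 2) *
    Real.exp (lam ^ 2 / (2 * (n + lam ^ 2)) *
      ∑ i, (ω.2 i + lam * ω.1 ⟨0, hm⟩ i) ^ 2) /
    Real.exp (lam ^ 2 / 2 * (∑ i, (ω.1 ⟨0, hm⟩ i) ^ 2) +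
      lam * ∑ i, ω.1 ⟨0, hm⟩ i * ω.2 i)

/-- Chebyshev's inequality for a sum of functions of the coordinates of a product measure. -/
lemma pi_sum_deviation_le {ι : Type*} [Fintype ι] (μ : Measure ℝ) [IsProbabilityMeasure μ]
    (f : ι → ℝ → ℝ) (hf : ∀ i, MemLp (f i) 2 μ) {c : ℝ} (hc : 0 < c) :
    (Measure.pi fun _ : ι => μ) {x | c ≤ |∑ i, f i (x i) - ∑ i, ∫ t, f i t ∂μ|} ≤
      ENNReal.ofReal ((∑ i, Var[f i; μ]) / c ^ 2) := by
  have hf' : ∀ i, MemLp (fun x : ι → ℝ => f i (x i)) 2 (Measure.pi fun _ : ι => μ) := fun i =>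
    (hf i).comp_measurePreserving (measurePreserving_eval (fun _ : ι => μ) i)
  have hsum : MemLp (∑ i, fun x : ι → ℝ => f i (x i)) 2 (Measure.pi fun _ : ι => μ) :=
    memLp_finsetSum' _ fun i _ => hf' i
  have h := meas_ge_le_variance_div_sq hsum hc
  rw [variance_sum_pi hf] at h
  have hint : ∫ x, (∑ i, fun x : ι → ℝ => f i (x i)) x ∂(Measure.pi fun _ : ι => μ) =
      ∑ i, ∫ t, f i t ∂μ := by
    simp only [Finset.sum_apply]
    rw [integral_finsetSum _ fun i _ => (hf' i).integrable one_le_two]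
    exact Finset.sum_congr rfl fun i _ =>
      integral_comp_eval (μ := fun _ : ι => μ) (hf i).aestronglyMeasurable
  rw [hint] at h
  simpa only [Finset.sum_apply] using h

lemma memLp_sq_gaussianReal (v : ℝ≥0) : MemLp (fun t : ℝ => t ^ 2) 2 (gaussianReal 0 v) := by
  have h := memLp_id_gaussianReal (μ := 0) (v := v) 4
  have h2 := MemLp.mul (p := 4) (q := 4) (r := 2) h h (hpqr := ⟨by
    rw [← two_mul, show (4 : ℝ≥0∞) = 2 * 2 by norm_num, ENNReal.mul_inv (by simp) (by simp),
      ← mul_assoc, ENNReal.mul_inv_cancel (by simp) (by simp), one_mul]⟩)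
  refine h2.ae_eq (.of_forall fun t => ?_)
  simp [sq]

lemma integral_sq_gaussianReal (v : ℝ≥0) : ∫ t, t ^ 2 ∂gaussianReal 0 v = v := by
  have h := variance_eq_integral (μ := gaussianReal 0 v) (X := fun t => t) (by fun_prop)
  rw [variance_fun_id_gaussianReal, integral_id_gaussianReal] at h
  simpa using h.symm

lemma variance_sq_gaussianReal (v : ℝ≥0) :
    Var[fun t => t ^ 2; gaussianReal 0 v] =
      (v : ℝ) ^ 2 * Var[fun t => t ^ 2; gaussianReal 0 1] := by
  have h : (gaussianReal 0 1).map (√(v : ℝ) * ·) = gaussianReal 0 v := by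
    rw [gaussianReal_map_const_mul]
    congr 1
    · simp
    · ext
      simp
  rw [← h, variance_map (by fun_prop) (by fun_prop), ← variance_const_mul]
  congr 1
  ext t
  simp [mul_pow]

lemma gaussian_norm_sq_deviation_le {n : ℕ} (hn : 0 < n) {v : ℝ≥0} (hv : 0 < v) {ε : ℝ}
    (hε : 0 < ε) :
    (Measure.pi fun _ : Fin n => gaussianReal 0 v) {x | ε * (n * v) ≤ |∑ i, x i ^ 2 - n * v|} ≤
      ENNReal.ofReal (Var[fun t => t ^ 2; gaussianReal 0 1] / ε ^ 2 / n) := by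
  have hn' : (0 : ℝ) < n := Nat.cast_pos.2 hn
  have hv' : (0 : ℝ) < v := hv
  have h := pi_sum_deviation_le (gaussianReal 0 v) (fun (_ : Fin n) t => t ^ 2)
    (fun _ => memLp_sq_gaussianReal v) (c := ε * (n * v)) (by positivity)
  simp only [integral_sq_gaussianReal, Finset.sum_const, Finset.card_univ, Fintype.card_fin,
    nsmul_eq_mul] at h
  rw [variance_sq_gaussianReal v] at h
  refine h.trans_eq ?_
  congr 1
  field_simp

lemma gaussian_inner_tail_le {n : ℕ} (x : Fin n → ℝ) {c t : ℝ} (hx : ∑ i, x i ^ 2 ≤ c)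
    (ht : 0 < t) :
    (Measure.pi fun _ : Fin n => gaussianReal 0 1) {z | t ≤ |∑ i, x i * z i|} ≤
      ENNReal.ofReal (c / t ^ 2) := by
  have h := pi_sum_deviation_le (gaussianReal 0 1) (fun i s => x i * s)
    (fun i => (memLp_id_gaussianReal 2).const_mul (x i)) ht
  have hint : ∑ i, ∫ s, x i * s ∂gaussianReal 0 1 = 0 :=
    Finset.sum_eq_zero fun i _ => by
      rw [integral_const_mul, integral_id_gaussianReal, mul_zero]
  have hvar : ∑ i, Var[fun s => x i * s; gaussianReal 0 1] = ∑ i, x i ^ 2 :=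
    Finset.sum_congr rfl fun i _ => by
      rw [variance_const_mul, variance_fun_id_gaussianReal, NNReal.coe_one, mul_one]
  simp only [hint, hvar, sub_zero] at h
  exact h.trans (ENNReal.ofReal_le_ofReal (by gcongr))

lemma prod_le_of_forall_slice_le {α β : Type*} [MeasurableSpace α] [MeasurableSpace β]
    (μ : Measure α) [IsProbabilityMeasure μ] (ν : Measure β) [SFinite ν] {s : Set (α × β)}
    (hs : MeasurableSet s) {C : ℝ≥0∞} (h : ∀ x, ν (Prod.mk x ⁻¹' s) ≤ C) : μ.prod ν s ≤ C := by
  rw [Measure.prod_apply hs]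
  exact (lintegral_mono h).trans (by simp)

lemma sum_add_mul_sq {n : ℕ} (x z : Fin n → ℝ) (r : ℝ) :
    ∑ i, (z i + r * x i) ^ 2 =
      ∑ i, z i ^ 2 + 2 * r * ∑ i, x i * z i + r ^ 2 * ∑ i, x i ^ 2 := by
  simp only [Finset.mul_sum, ← Finset.sum_add_distrib]
  exact Finset.sum_congr rfl fun i _ => by ring

/-- The exponent of `Bnm`, up to the factor `m - 1`, on the typical event. -/
lemma exponent_lower_bound {n L r δ S Q D : ℝ} (hn : 0 < n) (hδ : δ ∈ Set.Ioo (0 : ℝ) 1)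
    (hL : 0 ≤ L) (hr : 0 < r) (hrL : r ^ 2 ≤ (2 - δ) * L) (hrn : r ^ 2 ≤ δ / 20 * n)
    (hS0 : 0 ≤ S) (hS : S ≤ 1 + δ / 20) (hQ : (1 - δ / 20) * n ≤ Q) (hD : |D| ≤ δ / 20 * √L) :
    -L + δ / 4 * L ≤ -(r ^ 2 / 2) +
      (r ^ 2 / (2 * (n + r ^ 2)) * (Q + 2 * r * D + r ^ 2 * S) - (r ^ 2 / 2 * S + r * D)) := by
  obtain ⟨hδ0, hδ1⟩ := hδ
  set c := r ^ 2 / (2 * (n + r ^ 2)) with hc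
  have hc0 : 0 ≤ c := by positivity
  have hcn : c * (n + r ^ 2) = r ^ 2 / 2 := by rw [hc]; field_simp
  have hc1 : 2 * c ≤ 1 := by
    rw [hc, ← mul_div_assoc, div_le_one (by positivity)]; linarith
  have hQ' : r ^ 2 / 2 * (1 - δ / 10) ≤ c * Q := by
    rw [← hcn, mul_assoc]
    refine mul_le_mul_of_nonneg_left ?_ hc0
    nlinarith [sq_nonneg r]
  have hrs : r ≤ 2 * √L := by
    refine abs_le_of_sq_le_sq' ?_ (by positivity) |>.2
    rw [mul_pow, Real.sq_sqrt hL]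
    nlinarith
  have hrD : r * |D| ≤ δ / 10 * L := by
    calc r * |D| ≤ 2 * √L * (δ / 20 * √L) := by gcongr
      _ = δ / 10 * (√L * √L) := by ring
      _ = δ / 10 * L := by rw [Real.mul_self_sqrt hL]
  have hD' : -(r * |D|) ≤ (2 * c - 1) * (r * D) := by
    have h1 : |(2 * c - 1) * (r * D)| ≤ r * |D| := by
      rw [abs_mul, abs_mul, abs_of_pos hr]
      refine mul_le_of_le_one_left (by positivity) (abs_le.2 ⟨by linarith, by linarith⟩)
    exact (abs_le.1 h1).1.trans' (by linarith)
  have hcS : 0 ≤ c * (r ^ 2 * S) := by positivity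
  have hrS : r ^ 2 / 2 * S ≤ r ^ 2 / 2 * (1 + δ / 20) := by gcongr
  have hfin : r ^ 2 / 2 * (1 + 3 * (δ / 20)) ≤ (2 - δ) * L / 2 * (1 + 3 * (δ / 20)) := by gcongr
  nlinarith [mul_nonneg (mul_nonneg hδ0.le hδ0.le) hL]

lemma lt_Bnm_of_typical {n m : ℕ} (hn : 0 < n) (hm : 0 < m) (hm2 : 2 ≤ m) {r δ M : ℝ}
    (hδ : δ ∈ Set.Ioo (0 : ℝ) 1) (hr : 0 < r) (hrL : r ^ 2 ≤ (2 - δ) * Real.log m)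
    (hrn : r ^ 2 ≤ δ / 20 * n) (hM : M < Real.exp (δ / 4 * Real.log m) / 2)
    (ω : (Fin m → Fin n → ℝ) × (Fin n → ℝ))
    (hS : ∑ i, ω.1 ⟨0, hm⟩ i ^ 2 ≤ 1 + δ / 20) (hQ : (1 - δ / 20) * n ≤ ∑ i, ω.2 i ^ 2)
    (hD : |∑ i, ω.1 ⟨0, hm⟩ i * ω.2 i| ≤ δ / 20 * √(Real.log m)) :
    M < Bnm n m hm r ω := by
  have hn' : (0 : ℝ) < n := Nat.cast_pos.2 hn
  have hm' : (2 : ℝ) ≤ m := by exact_mod_cast hm2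
  have hL : 0 ≤ Real.log m := Real.log_nonneg (by linarith)
  have hexp := exponent_lower_bound hn' hδ hL hr hrL hrn (by positivity) hS hQ hD
  have hpow : Real.exp (-(r ^ 2 / 2)) ≤ (1 + r ^ 2 / n) ^ (-(n : ℝ) / 2) := by
    have ha : 0 < 1 + r ^ 2 / n := by positivity
    rw [Real.rpow_def_of_pos ha, Real.exp_le_exp]
    have hlog : Real.log (1 + r ^ 2 / n) ≤ r ^ 2 / n := by
      linarith [Real.log_le_sub_one_of_pos ha]
    have h : Real.log (1 + r ^ 2 / n) * n ≤ r ^ 2 := by rwa [← le_div_iff₀ hn']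
    linarith
  refine hM.trans_le ?_
  rw [Bnm, sum_add_mul_sq, mul_div_assoc, ← Real.exp_sub]
  have hm1 : Real.exp (Real.log m) / 2 ≤ (m : ℝ) - 1 := by
    rw [Real.exp_log (by linarith)]; linarith
  have hm1' : 0 ≤ (m : ℝ) - 1 := by linarith
  refine (?_ : _ ≤ Real.exp (Real.log m) / 2 * Real.exp (-(r ^ 2 / 2)) * _).trans
    (mul_le_mul_of_nonneg_right (mul_le_mul hm1 hpow (Real.exp_nonneg _) hm1')
      (Real.exp_nonneg _))
  rw [mul_assoc, ← Real.exp_add, div_mul_eq_mul_div (Real.exp (Real.log m)), ← Real.exp_add]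
  gcongr
  linarith

/-- A quantitative lower bound for the probability that `Bnm` is large. -/
lemma one_sub_le_XZlaw_lt_Bnm {n m : ℕ} (hn : 0 < n) (hm : 0 < m) (hm2 : 2 ≤ m) {r δ M : ℝ}
    (hδ : δ ∈ Set.Ioo (0 : ℝ) 1) (hr : 0 < r) (hrL : r ^ 2 ≤ (2 - δ) * Real.log m)
    (hrn : r ^ 2 ≤ δ / 20 * n) (hM : M < Real.exp (δ / 4 * Real.log m) / 2) :
    1 - (ENNReal.ofReal (Var[fun t => t ^ 2; gaussianReal 0 1] / (δ / 20) ^ 2 / n) +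
      ENNReal.ofReal (Var[fun t => t ^ 2; gaussianReal 0 1] / (δ / 20) ^ 2 / n) +
      ENNReal.ofReal (2 / (δ / 20) ^ 2 / Real.log m)) ≤ XZlaw n m {ω | M < Bnm n m hm r ω} := by
  have hδ0 : 0 < δ / 20 := div_pos hδ.1 (by norm_num)
  have hn' : (0 : ℝ) < n := Nat.cast_pos.2 hn
  have hm' : (2 : ℝ) ≤ m := by exact_mod_cast hm2
  have hL : 0 < Real.log m := Real.log_pos (by linarith)
  have hinv : (0 : ℝ≥0) < (n : ℝ≥0)⁻¹ := by positivity
  have hprob : IsProbabilityMeasure (XZlaw n m) := by unfold XZlaw; infer_instance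
  set A : Set (Fin n → ℝ) := {x | δ / 20 * (n * ((n : ℝ≥0)⁻¹ : ℝ≥0)) ≤
    |∑ i, x i ^ 2 - n * ((n : ℝ≥0)⁻¹ : ℝ≥0)|} with hA
  set B : Set (Fin n → ℝ) := {x | δ / 20 * (n * (1 : ℝ≥0)) ≤ |∑ i, x i ^ 2 - n * (1 : ℝ≥0)|} with hB
  have hAm : MeasurableSet A := measurableSet_le (by fun_prop) (by fun_prop)
  have hBm : MeasurableSet B := measurableSet_le (by fun_prop) (by fun_prop)
  set E₁ : Set ((Fin m → Fin n → ℝ) × (Fin n → ℝ)) := (fun ω => ω.1 ⟨0, hm⟩) ⁻¹' A with hE₁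
  set E₂ : Set ((Fin m → Fin n → ℝ) × (Fin n → ℝ)) := Prod.snd ⁻¹' B with hE₂
  set E₃ : Set ((Fin m → Fin n → ℝ) × (Fin n → ℝ)) :=
    {ω | δ / 20 * √(Real.log m) ≤ |∑ i, ω.1 ⟨0, hm⟩ i * ω.2 i|} ∩
      {ω | ∑ i, ω.1 ⟨0, hm⟩ i ^ 2 ≤ 2} with hE₃
  have hE₃m : MeasurableSet E₃ :=
    (measurableSet_le (by fun_prop) (by fun_prop)).inter
      (measurableSet_le (by fun_prop) (by fun_prop))
  have h₁ : XZlaw n m E₁ ≤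
      ENNReal.ofReal (Var[fun t => t ^ 2; gaussianReal 0 1] / (δ / 20) ^ 2 / n) := by
    have hmp : MeasurePreserving
        (fun ω : (Fin m → Fin n → ℝ) × (Fin n → ℝ) => ω.1 ⟨0, hm⟩) (XZlaw n m)
        (Measure.pi fun _ : Fin n => gaussianReal 0 (n : ℝ≥0)⁻¹) :=
      (measurePreserving_eval (fun _ : Fin m =>
        Measure.pi fun _ : Fin n => gaussianReal 0 (n : ℝ≥0)⁻¹) ⟨0, hm⟩).comp
        measurePreserving_fst
    rw [hE₁, hmp.measure_preimage hAm.nullMeasurableSet]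
    exact gaussian_norm_sq_deviation_le hn hinv hδ0
  have h₂ : XZlaw n m E₂ ≤
      ENNReal.ofReal (Var[fun t => t ^ 2; gaussianReal 0 1] / (δ / 20) ^ 2 / n) := by
    have hmp : MeasurePreserving Prod.snd (XZlaw n m)
        (Measure.pi fun _ : Fin n => gaussianReal 0 1) := measurePreserving_snd
    rw [hE₂, hmp.measure_preimage hBm.nullMeasurableSet]
    exact gaussian_norm_sq_deviation_le hn one_pos hδ0
  have h₃ : XZlaw n m E₃ ≤ ENNReal.ofReal (2 / (δ / 20) ^ 2 / Real.log m) := by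
    refine prod_le_of_forall_slice_le _ _ hE₃m fun x => ?_
    by_cases hx : ∑ i, x ⟨0, hm⟩ i ^ 2 ≤ 2
    · have h := gaussian_inner_tail_le (x ⟨0, hm⟩) hx (t := δ / 20 * √(Real.log m))
        (by positivity)
      rw [mul_pow, Real.sq_sqrt hL.le, ← div_div] at h
      exact (measure_mono fun z hz => hz.1).trans h
    · have : Prod.mk x ⁻¹' E₃ = ∅ := Set.eq_empty_of_forall_notMem fun z hz => hx hz.2
      simp [this]
  have hbad : XZlaw n m (E₁ ∪ E₂ ∪ E₃) ≤ _ :=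
    (measure_union_le _ _).trans (add_le_add ((measure_union_le _ _).trans (add_le_add h₁ h₂)) h₃)
  have hmeas : MeasurableSet (E₁ ∪ E₂ ∪ E₃) :=
    ((hAm.preimage (by fun_prop)).union (hBm.preimage measurable_snd)).union hE₃m
  refine (tsub_le_tsub_left hbad 1).trans ?_
  rw [← prob_compl_eq_one_sub hmeas]
  refine measure_mono fun ω hω => ?_
  simp only [Set.mem_compl_iff, Set.mem_union, not_or] at hω
  obtain ⟨⟨hω₁, hω₂⟩, hω₃⟩ := hω
  have hnn : (n : ℝ) * ((n : ℝ≥0)⁻¹ : ℝ≥0) = 1 := by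
    push_cast
    exact mul_inv_cancel₀ hn'.ne'
  have hω₁' : |∑ i, ω.1 ⟨0, hm⟩ i ^ 2 - 1| < δ / 20 := by
    simpa only [hE₁, hA, hnn, Set.mem_preimage, Set.mem_ofPred_eq, not_le, mul_one] using hω₁
  have hω₂' : |∑ i, ω.2 i ^ 2 - n| < δ / 20 * n := by
    simpa only [hE₂, hB, Set.mem_preimage, Set.mem_ofPred_eq, not_le, NNReal.coe_one,
      mul_one] using hω₂
  have hS : ∑ i, ω.1 ⟨0, hm⟩ i ^ 2 ≤ 1 + δ / 20 := by linarith [(abs_lt.1 hω₁').2]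
  refine lt_Bnm_of_typical hn hm hm2 hδ hr hrL hrn hM ω hS (by linarith [(abs_lt.1 hω₂').1]) ?_
  by_contra! h
  exact hω₃ ⟨h.le, by simpa using hS.trans (by linarith [hδ.2])⟩

/-- **Lemma 13.** If `m → ∞`, `(log m)/n → 0`, `λ_n > 0` and
`λ_n² ≤ (2−δ) log m_n` for a fixed `δ ∈ (0,1)`, then `ℬ_{n,m} → ∞` in probability:
for every `M > 0`, `P(ℬ_{n,m} > M) → 1`. -/
theorem Bnm_tendsto_infty_in_probability
    (m : ℕ → ℕ) (lam : ℕ → ℝ) (δ : ℝ) (hδ : δ ∈ Set.Ioo (0 : ℝ) 1)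
    (hm0 : ∀ n, 0 < m n)
    (hm : Tendsto (fun n => (m n : ℝ)) atTop atTop)
    (hlog : Tendsto (fun n => Real.log (m n) / n) atTop (nhds 0))
    (hlam : ∀ n, 0 < lam n)
    (hlam2 : ∀ n, lam n ^ 2 ≤ (2 - δ) * Real.log (m n)) :
    ∀ M : ℝ, 0 < M →
      Tendsto (fun n => XZlaw n (m n) {ω | M < Bnm n (m n) (hm0 n) (lam n) ω})
        atTop (nhds (1 : ℝ≥0∞)) := by
  intro M hM
  have hδ0 : 0 < δ / 20 := div_pos hδ.1 (by norm_num)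
  have hL : Tendsto (fun n => Real.log (m n)) atTop atTop := Real.tendsto_log_atTop.comp hm
  have hn : Tendsto (fun n : ℕ => (n : ℝ)) atTop atTop := tendsto_natCast_atTop_atTop
  have hexp : Tendsto (fun n => Real.exp (δ / 4 * Real.log (m n)) / 2) atTop atTop :=
    (Real.tendsto_exp_atTop.comp
      (hL.const_mul_atTop (div_pos hδ.1 (by norm_num)))).atTop_div_const two_pos
  have hlow : Tendsto (fun n : ℕ =>
      1 - (ENNReal.ofReal (Var[fun t => t ^ 2; gaussianReal 0 1] / (δ / 20) ^ 2 / n) +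
        ENNReal.ofReal (Var[fun t => t ^ 2; gaussianReal 0 1] / (δ / 20) ^ 2 / n) +
        ENNReal.ofReal (2 / (δ / 20) ^ 2 / Real.log (m n)))) atTop (nhds 1) := by
    have h₁ := ENNReal.tendsto_ofReal
      (hn.const_div_atTop (Var[fun t => t ^ 2; gaussianReal 0 1] / (δ / 20) ^ 2))
    have h₂ := ENNReal.tendsto_ofReal (hL.const_div_atTop (2 / (δ / 20) ^ 2))
    simpa using ENNReal.Tendsto.sub (tendsto_const_nhds (x := (1 : ℝ≥0∞)))
      ((h₁.add h₁).add h₂) (Or.inl ENNReal.one_ne_top)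
  refine tendsto_of_tendsto_of_tendsto_of_le_of_le' hlow tendsto_const_nhds ?_
    (.of_forall fun n => ?_)
  · filter_upwards [eventually_gt_atTop 0, hm.eventually_ge_atTop 2, hexp.eventually_gt_atTop M,
      hlog.eventually_le_const (half_pos hδ0)] with n hn0 hm2 hMn hln
    have hn' : (0 : ℝ) < n := Nat.cast_pos.2 hn0
    rw [div_le_iff₀ hn'] at hln
    have hLn : 0 ≤ Real.log (m n) := Real.log_nonneg (by linarith)
    refine one_sub_le_XZlaw_lt_Bnm hn0 (hm0 n) (by exact_mod_cast hm2) hδ (hlam n) (hlam2 n) ?_ hMn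
    nlinarith [hlam2 n, mul_nonneg hδ.1.le hLn]
  · have : IsProbabilityMeasure (XZlaw n (m n)) := by unfold XZlaw; infer_instance
    exact prob_le_one
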